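/- Let k ≥ 2 and 2 ≤ j ≤ k, and let p̃ < p < 1. Then there exists c > 0 such that for all L ≥ 1 the spectral gap of the oriented FA-jf model on the depth-L rooted k-ary tree with unconstrained leaves satisfies gap_L ≤ e^{-L/c}, where gap_L = inf{ D_L(f)/Var_μ(f) : f : Ω_L → ℝ nonconstant } and D_L(f) = ∑_{x ∈ V_L} μ( c̄_x · Var_x(f) ). -/

import Mathlib

open scoped Classical

noncomputable section

/-- The bootstrap recursion map `g_p(x) = p·∑_{i=k-j+1}^{k} C(k,i) xⁱ (1-x)^{k-i}`. -/
def g (k j : ℕ) (p x : ℝ) : ℝ :=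
  p * ∑ i ∈ Finset.Icc (k - j + 1) k, (Nat.choose k i : ℝ) * x ^ i * (1 - x) ^ (k - i)

/-- The critical threshold `p̃`: the supremum of the densities `p ∈ [0,1]` for which
`x = 0` is the unique fixed point of `g_p` in `[0,1]`. -/
def ptilde (k j : ℕ) : ℝ :=
  sSup {p : ℝ | p ∈ Set.Icc (0 : ℝ) 1 ∧ ∀ x ∈ Set.Icc (0 : ℝ) 1, g k j p x = x → x = 0}

section Bernoulli

variable {V : Type*} [Fintype V] [DecidableEq V]

/-- Bernoulli(p) product weight of a configuration (`true` = occupied, with probability `p`). -/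
def wt (p : ℝ) (η : V → Bool) : ℝ := ∏ x : V, if η x then p else 1 - p

/-- Expectation under the Bernoulli(p) product measure μ. -/
def mean (p : ℝ) (f : (V → Bool) → ℝ) : ℝ := ∑ η : V → Bool, wt p η * f η

/-- Probability of an event under the Bernoulli(p) product measure μ. -/
def probEv (p : ℝ) (E : (V → Bool) → Prop) : ℝ := mean p (fun η => if E η then 1 else 0)

/-- Conditional expectation `μ_A(f)` of `f` given the coordinates outside `A`. -/
def cexp (p : ℝ) (A : Finset V) (f : (V → Bool) → ℝ) (η : V → Bool) : ℝ :=
  ∑ ζ : V → Bool,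
    (∏ x : V, if x ∈ A then (if ζ x then p else 1 - p) else (if ζ x = η x then 1 else 0)) * f ζ

/-- Conditional variance `Var_A(f)` on the coordinates of `A` given the remaining coordinates. -/
def cvar (p : ℝ) (A : Finset V) (f : (V → Bool) → ℝ) (η : V → Bool) : ℝ :=
  cexp p A (fun ζ => f ζ ^ 2) η - (cexp p A f η) ^ 2

/-- Variance `Var_μ(f)` under the Bernoulli(p) product measure. -/
def varTot (p : ℝ) (f : (V → Bool) → ℝ) : ℝ := mean p (fun η => f η ^ 2) - (mean p f) ^ 2

end Bernoulli

/-- Vertices of the rooted `k`-ary tree of depth `n`: words of length `≤ n` over `Fin k`. -/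
abbrev TV (k n : ℕ) := Σ m : Fin (n + 1), Fin m.val → Fin k

/-- The root: the empty word. -/
def rootT (k n : ℕ) : TV k n := ⟨⟨0, Nat.succ_pos n⟩, Fin.elim0⟩

/-- `y` is a child of `x` in the rooted tree. -/
def childOf {k n : ℕ} (x y : TV k n) : Prop :=
  ∃ h : y.1.val = x.1.val + 1, ∀ i : Fin x.1.val, y.2 (Fin.cast h.symm i.castSucc) = x.2 i

/-- The oriented bootstrap map `B̄`: a vertex becomes empty iff it is already empty or
at least `j` of its children are empty. -/
def bootO {k n : ℕ} (j : ℕ) (η : TV k n → Bool) : TV k n → Bool := fun x =>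
  if η x = false ∨ j ≤ (Finset.univ.filter fun y : TV k n => childOf x y ∧ η y = false).card
  then false else true

/-- The oriented FA-jf constraint with unconstrained leaves: `c̄_x(η) = 1` iff `x` is a leaf
(depth `n`) or at least `j` children of `x` are empty. -/
def cbar {k n : ℕ} (j : ℕ) (x : TV k n) (η : TV k n → Bool) : ℝ :=
  if x.1.val = n then 1
  else if j ≤ (Finset.univ.filter fun y : TV k n => childOf x y ∧ η y = false).card then 1 else 0

/-- The Dirichlet form of the oriented FA-jf model on the depth-`L` rooted `k`-ary tree. -/
def dirO (k j L : ℕ) (p : ℝ) (f : (TV k L → Bool) → ℝ) : ℝ :=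
  ∑ x : TV k L, mean p (fun η => cbar j x η * cvar p {x} f η)

/-- The spectral gap of the oriented FA-jf model on the depth-`L` rooted `k`-ary tree:
the infimum over nonconstant `f` of `D_L(f)/Var_μ(f)`. -/
def gapO (k j L : ℕ) (p : ℝ) : ℝ :=
  sInf {r : ℝ | ∃ f : (TV k L → Bool) → ℝ, varTot p f ≠ 0 ∧ r = dirO k j L p f / varTot p f}

/-! ### The Bernoulli product measure -/

section Bernoulli

variable {V : Type*} [Fintype V] [DecidableEq V]

lemma mean_const_one (p : ℝ) : mean p (fun _ : V → Bool => 1) = 1 := by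
  have h := Finset.prod_univ_sum (fun _ : V => (Finset.univ : Finset Bool))
    (fun _ b => if b then p else 1 - p)
  simp only [Fintype.piFinset_univ] at h
  simp only [mean, wt, mul_one]
  rw [← h]
  simp

lemma cexp_singleton (p : ℝ) (x : V) (f : (V → Bool) → ℝ) (η : V → Bool) :
    cexp p {x} f η =
      p * f (Function.update η x true) + (1 - p) * f (Function.update η x false) := by
  have hne : Function.update η x true ≠ Function.update η x false := fun h => by
    simpa using congrFun h x
  have hw (b : Bool) : (∏ y : V, if y ∈ ({x} : Finset V) then
      (if Function.update η x b y then p else 1 - p)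
      else (if Function.update η x b y = η y then (1 : ℝ) else 0)) = if b then p else 1 - p := by
    rw [Finset.prod_eq_single x]
    · simp
    · intro y _ hy
      simp [hy]
    · simp
  unfold cexp
  rw [← Finset.sum_subset
    (Finset.subset_univ {Function.update η x true, Function.update η x false}),
    Finset.sum_pair hne, hw, hw]
  · simp
  · intro ζ _ hζ
    have : ∃ y, y ≠ x ∧ ζ y ≠ η y := by
      by_contra! h
      have hζ' : ζ = Function.update η x (ζ x) := by
        rw [Function.eq_update_iff]
        exact ⟨rfl, h⟩
      rw [Finset.mem_insert, Finset.mem_singleton] at hζ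
      cases hb : ζ x
      · exact hζ (Or.inr (hb ▸ hζ'))
      · exact hζ (Or.inl (hb ▸ hζ'))
    obtain ⟨y, hyx, hy⟩ := this
    rw [Finset.prod_eq_zero (Finset.mem_univ y) (by simp [hyx, hy]), zero_mul]

lemma cvar_singleton (p : ℝ) (x : V) (f : (V → Bool) → ℝ) (η : V → Bool) :
    cvar p {x} f η =
      p * (1 - p) * (f (Function.update η x true) - f (Function.update η x false)) ^ 2 := by
  simp only [cvar, cexp_singleton]
  ring

end Bernoulli

/-! ### Sums over independent copies -/

section Product

variable {ι Ω : Type*} [Fintype ι] [DecidableEq ι] [Fintype Ω]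

lemma sum_prod_mul_card (w : Ω → ℝ) (hw : ∑ ω, w ω = 1) (A : Ω → Bool) (Φ : ℕ → ℝ) :
    ∑ ξ : ι → Ω, (∏ c, w (ξ c)) * Φ (Finset.univ.filter fun c => A (ξ c) = true).card =
      ∑ i ∈ Finset.range (Fintype.card ι + 1), ((Fintype.card ι).choose i : ℝ) *
        (∑ ω, w ω * if A ω then 1 else 0) ^ i *
        (1 - ∑ ω, w ω * if A ω then 1 else 0) ^ (Fintype.card ι - i) * Φ i := by
  set x : ℝ := ∑ ω, w ω * if A ω then 1 else 0 with hx
  have hx1 : ∑ ω ∈ Finset.univ.filter (fun ω => A ω = true), w ω = x := by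
    rw [hx, Finset.sum_filter]
    simp
  have hx0 : ∑ ω ∈ Finset.univ.filter (fun ω => ¬ A ω = true), w ω = 1 - x := by
    rw [← hw, ← Finset.sum_filter_add_sum_filter_not Finset.univ (fun ω => A ω = true) w, hx1]
    ring
  have hfib (S : Finset ι) :
      ∑ ξ : ι → Ω with (Finset.univ.filter fun c => A (ξ c) = true) = S, (∏ c, w (ξ c)) =
        x ^ S.card * (1 - x) ^ (Fintype.card ι - S.card) := by
    have hset : (Finset.univ.filter fun ξ : ι → Ω =>
        (Finset.univ.filter fun c => A (ξ c) = true) = S) =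
        Fintype.piFinset fun c => if c ∈ S then Finset.univ.filter (fun ω => A ω = true)
          else Finset.univ.filter (fun ω => ¬ A ω = true) := by
      ext ξ
      simp only [Finset.mem_filter, Finset.mem_univ, true_and, Fintype.mem_piFinset,
        Finset.ext_iff]
      refine forall_congr' fun c => ?_
      by_cases hc : c ∈ S <;> simp [hc]
    rw [hset, ← Finset.prod_univ_sum]
    have hterm (c : ι) : ∑ ω ∈ (if c ∈ S then Finset.univ.filter (fun ω => A ω = true)
          else Finset.univ.filter (fun ω => ¬ A ω = true)), w ω =
        if c ∈ S then x else 1 - x := by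
      split_ifs
      · exact hx1
      · exact hx0
    simp only [hterm]
    rw [Finset.prod_ite, Finset.prod_const, Finset.prod_const]
    congr 2
    · simp
    · rw [Finset.filter_not, Finset.card_sdiff_of_subset (Finset.filter_subset _ _)]
      simp
  rw [← Finset.sum_fiberwise Finset.univ
    (fun ξ : ι → Ω => Finset.univ.filter fun c => A (ξ c) = true)]
  have h := Finset.sum_powerset_apply_card
    (fun i => x ^ i * (1 - x) ^ (Fintype.card ι - i) * Φ i) (x := (Finset.univ : Finset ι))
  rw [Finset.powerset_univ] at h
  trans ∑ S : Finset ι, x ^ S.card * (1 - x) ^ (Fintype.card ι - S.card) * Φ S.card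
  · refine Finset.sum_congr rfl fun S _ => ?_
    rw [← hfib S, Finset.sum_mul]
    refine Finset.sum_congr rfl fun ξ hξ => ?_
    rw [(Finset.mem_filter.mp hξ).2]
  · rw [h, Finset.card_univ]
    refine Finset.sum_congr rfl fun i _ => ?_
    rw [nsmul_eq_mul]
    ring

lemma sum_prod_mul_exchange (w : Ω → ℝ) (a : ι) (S T : Ω → ℝ) (R : (ι → Ω) → ℝ)
    (hR : ∀ ξ ω, R (Function.update ξ a ω) = R ξ) :
    (∑ ω, w ω * T ω) * ∑ ξ : ι → Ω, (∏ c, w (ξ c)) * (S (ξ a) * R ξ) =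
      (∑ ω, w ω * S ω) * ∑ ξ : ι → Ω, (∏ c, w (ξ c)) * (T (ξ a) * R ξ) := by
  rw [Finset.sum_mul_sum, Finset.sum_mul_sum, ← Fintype.sum_prod_type', ← Fintype.sum_prod_type']
  let φ : Ω × (ι → Ω) → Ω × (ι → Ω) := fun z => (z.2 a, Function.update z.2 a z.1)
  have hφ : Function.Involutive φ := fun z => by simp [φ]
  rw [← Equiv.sum_comp (hφ.toPerm φ)]
  refine Finset.sum_congr rfl fun z _ => ?_
  simp only [Function.Involutive.coe_toPerm, φ, hR, Function.update_self]
  rw [← Finset.mul_prod_erase Finset.univ (fun c => w (z.2 c)) (Finset.mem_univ a),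
    ← Finset.mul_prod_erase Finset.univ (fun c => w (Function.update z.2 a z.1 c))
      (Finset.mem_univ a), Function.update_self]
  have : ∏ c ∈ Finset.univ.erase a, w (Function.update z.2 a z.1 c) =
      ∏ c ∈ Finset.univ.erase a, w (z.2 c) :=
    Finset.prod_congr rfl fun c hc => by rw [Function.update_of_ne (Finset.ne_of_mem_erase hc)]
  rw [this]
  ring

end Product

/-! ### Tails of the binomial distribution -/

/-- The probability that a binomial variable with parameters `k` and `x` is at least `m`. -/
def binomTail (k m : ℕ) (x : ℝ) : ℝ :=
  ∑ i ∈ Finset.Icc m k, (Nat.choose k i : ℝ) * x ^ i * (1 - x) ^ (k - i)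

/-- `m` times the probability that a binomial variable with parameters `k` and `x` equals `m`. -/
def binomPivot (k m : ℕ) (x : ℝ) : ℝ :=
  m * ((Nat.choose k m : ℝ) * x ^ m * (1 - x) ^ (k - m))

lemma g_eq (k j : ℕ) (p x : ℝ) : g k j p x = p * binomTail k (k - j + 1) x := rfl

lemma continuous_binomTail (k m : ℕ) : Continuous (binomTail k m) := by
  unfold binomTail
  fun_prop

lemma binomTail_one {k m : ℕ} (hmk : m ≤ k) : binomTail k m 1 = 1 := by
  unfold binomTail
  rw [Finset.sum_eq_single_of_mem k (by simp [hmk])]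
  · simp
  · intro i hi hik
    have : k - i ≠ 0 := by
      have := (Finset.mem_Icc.mp hi).2
      omega
    simp [this]

lemma hasDerivAt_binomTail (k m : ℕ) (x : ℝ) :
    HasDerivAt (binomTail (k + 1) (m + 1))
      ((k + 1 : ℝ) * (Nat.choose k m * x ^ m * (1 - x) ^ (k - m))) x := by
  by_cases hmk : m ≤ k
  swap
  · have hlt : k < m := not_le.mp hmk
    have h0 : binomTail (k + 1) (m + 1) = fun _ => 0 := by
      funext y
      simp [binomTail, hlt]
    rw [h0, Nat.choose_eq_zero_of_lt hlt]
    simpa using hasDerivAt_const x (0 : ℝ)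
  have hpoly : binomTail (k + 1) (m + 1) = fun y =>
      (∑ i ∈ Finset.Ico m (k + 1), bernsteinPolynomial ℝ (k + 1) (i + 1)).eval y := by
    funext y
    rw [Polynomial.eval_finsetSum, binomTail, Finset.sum_Ico_add'
      (fun i => (bernsteinPolynomial ℝ (k + 1) i).eval y) m (k + 1) 1]
    exact Finset.sum_congr (by ext; simp) fun i _ => by simp [bernsteinPolynomial]
  rw [hpoly]
  refine (Polynomial.hasDerivAt _ x).congr_deriv ?_
  rw [Polynomial.derivative_sum]
  simp only [bernsteinPolynomial.derivative_succ, Nat.add_sub_cancel]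
  rw [← Finset.mul_sum, Finset.sum_Ico_eq_sum_range]
  have htel := Finset.sum_range_sub' (fun i => bernsteinPolynomial ℝ k (m + i)) (k + 1 - m)
  simp only [← add_assoc] at htel
  rw [htel, bernsteinPolynomial.eq_zero_of_lt ℝ (show k < m + (k + 1 - m) by omega)]
  simp [bernsteinPolynomial]

lemma mul_deriv_binomTail {k m : ℕ} (hm : 1 ≤ m) (hmk : m ≤ k) (x : ℝ) :
    x * deriv (binomTail k m) x = binomPivot k m x := by
  obtain ⟨k, rfl⟩ : ∃ k', k = k' + 1 := ⟨k - 1, by omega⟩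
  obtain ⟨m, rfl⟩ : ∃ m', m = m' + 1 := ⟨m - 1, by omega⟩
  have h : ((k : ℝ) + 1) * Nat.choose k m = Nat.choose (k + 1) (m + 1) * (m + 1) := by
    exact_mod_cast Nat.add_one_mul_choose_eq k m
  rw [(hasDerivAt_binomTail k m x).deriv, binomPivot, Nat.add_sub_add_right]
  push_cast
  linear_combination (x ^ (m + 1) * (1 - x) ^ (k - m)) * h

lemma differentiable_binomTail {k m : ℕ} (hm : 1 ≤ m) (hmk : m ≤ k) :
    Differentiable ℝ (binomTail k m) := by
  obtain ⟨k, rfl⟩ : ∃ k', k = k' + 1 := ⟨k - 1, by omega⟩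
  obtain ⟨m, rfl⟩ : ∃ m', m = m' + 1 := ⟨m - 1, by omega⟩
  exact fun x => (hasDerivAt_binomTail k m x).differentiableAt

lemma binomPivot_pos {k m : ℕ} (hm : 1 ≤ m) (hmk : m ≤ k) {x : ℝ} (hx0 : 0 < x) (hx1 : x < 1) :
    0 < binomPivot k m x := by
  have h1 : (0 : ℝ) < m := by exact_mod_cast hm
  have h2 : (0 : ℝ) < Nat.choose k m := by exact_mod_cast Nat.choose_pos hmk
  have h3 : 0 < 1 - x := by linarith
  unfold binomPivot
  positivity

lemma monotoneOn_binomTail {k m : ℕ} (hm : 1 ≤ m) (hmk : m ≤ k) :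
    MonotoneOn (binomTail k m) (Set.Icc 0 1) := by
  refine monotoneOn_of_deriv_nonneg (convex_Icc 0 1) (continuous_binomTail k m).continuousOn
    (differentiable_binomTail hm hmk).differentiableOn fun x hx => ?_
  rw [interior_Icc] at hx
  have h := binomPivot_pos hm hmk hx.1 hx.2
  rw [← mul_deriv_binomTail hm hmk] at h
  exact (pos_of_mul_pos_right h hx.1.le).le

lemma binomPivot_mul_le (k m : ℕ) {x y : ℝ} (hx : 0 ≤ x) (hxy : x ≤ y) (hy : y ≤ 1) :
    binomPivot k m y * binomTail k m x ≤ binomPivot k m x * binomTail k m y := by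
  unfold binomPivot binomTail
  rw [Finset.mul_sum, Finset.mul_sum]
  refine Finset.sum_le_sum fun i hi => ?_
  obtain ⟨hmi, hik⟩ := Finset.mem_Icc.mp hi
  obtain ⟨d, rfl⟩ := Nat.exists_eq_add_of_le hmi
  have hkm : k - m = (k - (m + d)) + d := by omega
  have hy' : 0 ≤ 1 - y := by linarith
  have hx' : 0 ≤ 1 - x := by linarith
  have hy0 : 0 ≤ y := hx.trans hxy
  have key : ((1 - y) * x) ^ d ≤ ((1 - x) * y) ^ d :=
    pow_le_pow_left₀ (by positivity) (by nlinarith) d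
  rw [hkm]
  set e := k - (m + d)
  have hC : 0 ≤ (m : ℝ) * Nat.choose k m * Nat.choose k (m + d) * (x ^ m * y ^ m) *
      ((1 - x) ^ e * (1 - y) ^ e) := by positivity
  have := mul_le_mul_of_nonneg_left key hC
  rw [mul_pow, mul_pow] at this
  calc _ = _ := by ring
    _ ≤ _ := this
    _ = _ := by ring

lemma exists_fixedPoint_binomPivot_lt {k j : ℕ} {p : ℝ} (hj : 2 ≤ j) (hjk : j ≤ k)
    (hp1 : ptilde k j < p) (hp2 : p < 1) :
    ∃ w, 0 < w ∧ w < 1 ∧ p * binomTail k (k - j + 1) w = w ∧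
      binomPivot k (k - j + 1) w < binomTail k (k - j + 1) w := by
  set m := k - j + 1 with hmdef
  have hm : 1 ≤ m := by omega
  have hmk : m ≤ k := by omega
  have hbdd : BddAbove {p : ℝ | p ∈ Set.Icc (0 : ℝ) 1 ∧
      ∀ x ∈ Set.Icc (0 : ℝ) 1, g k j p x = x → x = 0} := ⟨1, fun _ h => h.1.2⟩
  have hpt : 0 ≤ ptilde k j :=
    le_csSup hbdd ⟨by simp, fun x _ h => by simpa [g] using h.symm⟩
  obtain ⟨p', hp'1, hp'2⟩ := exists_between hp1
  have hp'0 : 0 < p' := hpt.trans_lt hp'1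
  have hp0 : 0 < p := hp'0.trans hp'2
  obtain ⟨y, hy, hfix, hy0⟩ : ∃ y ∈ Set.Icc (0 : ℝ) 1, g k j p' y = y ∧ y ≠ 0 := by
    by_contra! h
    exact absurd (le_csSup hbdd ⟨⟨hp'0.le, (hp'2.trans hp2).le⟩, h⟩) (not_le.mpr hp'1)
  rw [g_eq, ← hmdef] at hfix
  have hypos : 0 < y := lt_of_le_of_ne hy.1 (Ne.symm hy0)
  have hTy : 0 < binomTail k m y := pos_of_mul_pos_right (hfix.symm ▸ hypos) hp'0.le
  have hTp : y < p * binomTail k m y := by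
    calc y = p' * binomTail k m y := hfix.symm
      _ < _ := mul_lt_mul_of_pos_right hp'2 hTy
  obtain ⟨w, hw, hwfix⟩ : ∃ w ∈ Set.Icc y 1, p * binomTail k m w - w = 0 := by
    have hc : ContinuousOn (fun x => p * binomTail k m x - x) (Set.Icc y 1) :=
      ((continuous_binomTail k m).const_smul p |>.sub continuous_id).continuousOn
    refine intermediate_value_Icc' hy.2 hc ⟨?_, ?_⟩
    · simp only [binomTail_one hmk]
      linarith
    · linarith
  have hwpos : 0 < w := hypos.trans_le hw.1
  have hw1 : w < 1 := by
    refine lt_of_le_of_ne hw.2 fun h => ?_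
    rw [h, binomTail_one hmk] at hwfix
    linarith
  refine ⟨w, hwpos, hw1, by linarith, ?_⟩
  by_contra! hge
  have hTw : 0 < binomTail k m w :=
    pos_of_mul_pos_right (show 0 < p * binomTail k m w by linarith) hp0.le
  have hdiff := differentiable_binomTail hm hmk
  have hmono : MonotoneOn (fun x => binomTail k m x / x) (Set.Icc y w) := by
    refine monotoneOn_of_deriv_nonneg (convex_Icc y w) ?_ ?_ ?_
    · exact hdiff.continuous.continuousOn.div continuousOn_id
        fun x hx => (hypos.trans_le hx.1).ne'
    · exact hdiff.differentiableOn.div differentiableOn_id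
        fun x hx => (hypos.trans_le (interior_subset hx).1).ne'
    · intro x hx
      have hx' := interior_subset hx
      have hx0 : 0 < x := hypos.trans_le hx'.1
      have hle := binomPivot_mul_le k m hx0.le hx'.2 hw1.le
      have hTx : 0 ≤ binomTail k m x :=
        hTy.le.trans (monotoneOn_binomTail hm hmk hy ⟨hx0.le, hx'.2.trans hw1.le⟩ hx'.1)
      have hBT : binomTail k m x ≤ binomPivot k m x := by
        refine le_of_mul_le_mul_right ?_ hTw
        nlinarith
      have hd := ((hdiff x).hasDerivAt.div (hasDerivAt_id x) hx0.ne').deriv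
      have hd' : deriv (fun x => binomTail k m x / x) x =
          (deriv (binomTail k m) x * x - binomTail k m x * 1) / x ^ 2 := hd
      rw [hd']
      have := mul_deriv_binomTail hm hmk x
      exact div_nonneg (by linarith) (by positivity)
  have hfin := hmono ⟨le_rfl, hw.1⟩ ⟨hw.1, le_rfl⟩ hw.1
  have hwT : binomTail k m w / w = 1 / p := by
    rw [div_eq_div_iff hwpos.ne' hp0.ne']
    linarith
  simp only [hwT] at hfin
  rw [div_le_div_iff₀ hypos hp0] at hfin
  linarith

/-! ### Recursive structure of the tree -/

section Tree

variable {k n : ℕ}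

/-- The vertex of the tree of depth `n + 1` at position `y` in the subtree below the child `a`
of the root. -/
def subT (a : Fin k) (y : TV k n) : TV k (n + 1) :=
  ⟨y.1.succ, (Fin.cons a y.2 : Fin (y.1.val + 1) → Fin k)⟩

lemma TV.ext_apply {x y : TV k n} (h : x.1.val = y.1.val)
    (h' : ∀ i : Fin x.1.val, x.2 i = y.2 (Fin.cast h i)) : x = y := by
  obtain ⟨⟨a, ha⟩, u⟩ := x
  obtain ⟨⟨b, hb⟩, v⟩ := y
  dsimp only at h
  subst h
  congr 1
  funext i
  exact h' i

lemma eq_rootT_of_depth_zero (x : TV k 0) : x = rootT k 0 :=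
  have hx : x.1.val = 0 := Nat.lt_one_iff.mp x.1.2
  TV.ext_apply hx fun i => (i.cast hx).elim0

lemma subT_ne_rootT (a : Fin k) (y : TV k n) : subT a y ≠ rootT k (n + 1) := fun h =>
  absurd (congrArg (fun z => z.1.val) h) (Nat.succ_ne_zero _)

lemma subT_inj {a b : Fin k} {x y : TV k n} (h : subT a x = subT b y) : a = b ∧ x = y := by
  obtain ⟨l, u⟩ := x
  obtain ⟨l', v⟩ := y
  have h1 : l.succ = l'.succ := congrArg Sigma.fst h
  obtain rfl := Fin.succ_injective _ h1
  have h2 : (Fin.cons a u : Fin (l.val + 1) → Fin k) = Fin.cons b v := by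
    simpa [subT] using h
  obtain ⟨rfl, rfl⟩ := Fin.cons_injective2 h2
  exact ⟨rfl, rfl⟩

lemma eq_rootT_or_subT (z : TV k (n + 1)) : z = rootT k (n + 1) ∨ ∃ a y, z = subT a y := by
  obtain ⟨⟨l, hl⟩, u⟩ := z
  cases l with
  | zero => exact Or.inl (TV.ext_apply rfl fun i => i.elim0)
  | succ l =>
    refine Or.inr ⟨u 0, ⟨⟨l, by omega⟩, Fin.tail u⟩, ?_⟩
    exact TV.ext_apply rfl fun i => by
      change u i = (Fin.cons (u 0) (Fin.tail u) : Fin (l + 1) → Fin k) i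
      rw [Fin.cons_self_tail]

/-- A tree of depth `n + 1` is a root together with `k` trees of depth `n`. -/
def treeEquiv (k n : ℕ) : Option (Fin k × TV k n) ≃ TV k (n + 1) :=
  Equiv.ofBijective (fun o => o.elim (rootT k (n + 1)) fun z => subT z.1 z.2) <| by
    constructor
    · rintro (_ | ⟨a, x⟩) (_ | ⟨b, y⟩) h
      · rfl
      · exact absurd h.symm (subT_ne_rootT b y)
      · exact absurd h (subT_ne_rootT a x)
      · obtain ⟨rfl, rfl⟩ := subT_inj h
        rfl
    · intro z
      obtain rfl | ⟨a, y, rfl⟩ := eq_rootT_or_subT z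
      · exact ⟨none, rfl⟩
      · exact ⟨some (a, y), rfl⟩

/-- A configuration is given by the state of the root and the configurations of the subtrees. -/
def configEquiv (k n : ℕ) : (TV k (n + 1) → Bool) ≃ Bool × (Fin k → TV k n → Bool) :=
  ((treeEquiv k n).symm.arrowCongr (Equiv.refl Bool)).trans
    (Equiv.piOptionEquivProd.trans
      ((Equiv.refl Bool).prodCongr (Equiv.curry (Fin k) (TV k n) Bool)))

lemma configEquiv_apply (η : TV k (n + 1) → Bool) :
    configEquiv k n η = (η (rootT k (n + 1)), fun a y => η (subT a y)) := rfl

lemma sum_tree_succ (F : TV k (n + 1) → ℝ) :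
    ∑ x, F x = F (rootT k (n + 1)) + ∑ a, ∑ y, F (subT a y) := by
  rw [← (treeEquiv k n).sum_comp, Fintype.sum_option, Fintype.sum_prod_type]
  rfl

lemma prod_tree_succ (F : TV k (n + 1) → ℝ) :
    ∏ x, F x = F (rootT k (n + 1)) * ∏ a, ∏ y, F (subT a y) := by
  rw [← (treeEquiv k n).prod_comp, Fintype.prod_option, Fintype.prod_prod_type]
  rfl

lemma mean_tree_succ (p : ℝ) (H : Bool → (Fin k → TV k n → Bool) → ℝ) :
    mean p (fun η : TV k (n + 1) → Bool =>
        H (η (rootT k (n + 1))) fun a y => η (subT a y)) =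
      ∑ ξ : Fin k → TV k n → Bool,
        (∏ a, wt p (ξ a)) * (p * H true ξ + (1 - p) * H false ξ) := by
  have hwt (η : TV k (n + 1) → Bool) : wt p η =
      (if η (rootT k (n + 1)) then p else 1 - p) * ∏ a, wt p fun y => η (subT a y) :=
    prod_tree_succ _
  have := (configEquiv k n).sum_comp fun z =>
    (if z.1 then p else 1 - p) * (∏ a, wt p (z.2 a)) * H z.1 z.2
  simp only [configEquiv_apply] at this
  simp only [mean, hwt]
  refine this.trans ?_
  rw [Fintype.sum_prod_type_right]
  refine Finset.sum_congr rfl fun ξ _ => ?_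
  rw [Fintype.sum_bool]
  simp only [if_true, Bool.false_eq_true, if_false]
  ring

lemma childOf_subT (a : Fin k) (x : TV k n) (z : TV k (n + 1)) :
    childOf (subT a x) z ↔ ∃ y, z = subT a y ∧ childOf x y := by
  constructor
  · rintro ⟨h, hz⟩
    obtain rfl | ⟨b, y, rfl⟩ := eq_rootT_or_subT z
    · exact absurd h (Nat.succ_ne_zero _).symm
    · have hl : y.1.val = x.1.val + 1 := Nat.succ_injective h
      have hb : b = a := hz ⟨0, Nat.succ_pos _⟩
      subst hb
      exact ⟨y, rfl, hl, fun i => hz i.succ⟩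
  · rintro ⟨y, rfl, h, hy⟩
    refine ⟨congrArg Nat.succ h, fun i => ?_⟩
    refine Fin.cases rfl (fun i => hy i) (i : Fin (x.1.val + 1))

lemma childOf_rootT (z : TV k (n + 1)) :
    childOf (rootT k (n + 1)) z ↔ ∃ a, z = subT a (rootT k n) := by
  constructor
  · rintro ⟨h, -⟩
    obtain rfl | ⟨b, y, rfl⟩ := eq_rootT_or_subT z
    · exact absurd h (Nat.succ_ne_zero _).symm
    · have hl : y.1.val = 0 := Nat.succ_injective h
      exact ⟨b, congrArg _ (TV.ext_apply hl fun i => (Fin.cast hl i).elim0)⟩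
  · rintro ⟨a, rfl⟩
    exact ⟨rfl, fun i => i.elim0⟩

lemma cbar_subT (j : ℕ) (a : Fin k) (x : TV k n) (η : TV k (n + 1) → Bool) :
    cbar j (subT a x) η = cbar j x fun y => η (subT a y) := by
  have hcard : (Finset.univ.filter fun z => childOf (subT a x) z ∧ η z = false).card =
      (Finset.univ.filter fun y => childOf x y ∧ η (subT a y) = false).card := by
    rw [← Finset.card_image_of_injective
      (Finset.univ.filter fun y => childOf x y ∧ η (subT a y) = false)
      (fun _ _ h => (subT_inj h).2 : Function.Injective (subT a))]
    congr 1
    ext z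
    simp only [Finset.mem_filter, Finset.mem_univ, true_and, Finset.mem_image, childOf_subT]
    constructor
    · rintro ⟨⟨y, rfl, hy⟩, hη⟩
      exact ⟨y, ⟨hy, hη⟩, rfl⟩
    · rintro ⟨y, ⟨hy, hη⟩, rfl⟩
      exact ⟨⟨y, rfl, hy⟩, hη⟩
  have hlen : (subT a x).1.val = n + 1 ↔ x.1.val = n := Nat.succ_inj
  simp only [cbar, hcard, hlen]

lemma cbar_rootT (j : ℕ) (η : TV k (n + 1) → Bool) :
    cbar j (rootT k (n + 1)) η =
      if j ≤ (Finset.univ.filter fun a => η (subT a (rootT k n)) = false).card then 1 else 0 := by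
  have hcard : (Finset.univ.filter fun z => childOf (rootT k (n + 1)) z ∧ η z = false).card =
      (Finset.univ.filter fun a => η (subT a (rootT k n)) = false).card := by
    rw [← Finset.card_image_of_injective
      (Finset.univ.filter fun a => η (subT a (rootT k n)) = false)
      (fun _ _ h => (subT_inj h).1 : Function.Injective fun a => subT a (rootT k n))]
    congr 1
    ext z
    simp only [Finset.mem_filter, Finset.mem_univ, true_and, Finset.mem_image, childOf_rootT]
    constructor
    · rintro ⟨⟨y, rfl⟩, hη⟩
      exact ⟨y, hη, rfl⟩
    · rintro ⟨y, hη, rfl⟩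
      exact ⟨⟨y, rfl⟩, hη⟩
  have hlen : (rootT k (n + 1)).1.val ≠ n + 1 := (Nat.succ_ne_zero n).symm
  simp only [cbar, hcard, hlen, if_false]

end Tree

/-! ### The blocked event -/

section Blocked

variable {k n : ℕ}

/-- Whether the root stays occupied under the bootstrap dynamics, in which an occupied vertex
stays occupied iff at least `m` of its children do. -/
def blocked (k m : ℕ) : (n : ℕ) → (TV k n → Bool) → Bool
  | 0, η => η (rootT k 0)
  | n + 1, η => η (rootT k (n + 1)) &&
      decide (m ≤ (Finset.univ.filter fun a => blocked k m n (fun y => η (subT a y)) = true).card)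

lemma rootT_of_blocked {m : ℕ} {η : TV k n → Bool} (h : blocked k m n η = true) :
    η (rootT k n) = true := by
  cases n with
  | zero => exact h
  | succ n => exact (Bool.and_eq_true_iff.mp h).1

/-- The indicator function of the blocked event. -/
def blockedInd (k m n : ℕ) (η : TV k n → Bool) : ℝ := if blocked k m n η then 1 else 0

lemma blockedInd_sq (m : ℕ) (η : TV k n → Bool) : blockedInd k m n η ^ 2 = blockedInd k m n η := by
  unfold blockedInd
  split_ifs <;> simp

/-- The probability of the blocked event. -/
def blockedProb (k m n : ℕ) (p : ℝ) : ℝ := mean p (blockedInd k m n)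

lemma varTot_blockedInd (m : ℕ) (p : ℝ) :
    varTot p (blockedInd k m n) = blockedProb k m n p * (1 - blockedProb k m n p) := by
  simp only [varTot, blockedInd_sq, blockedProb]
  ring

lemma mean_tree_zero (p : ℝ) (H : Bool → ℝ) :
    mean p (fun η : TV k 0 → Bool => H (η (rootT k 0))) = p * H true + (1 - p) * H false := by
  let : Unique (TV k 0) := ⟨⟨rootT k 0⟩, eq_rootT_of_depth_zero⟩
  unfold mean wt
  rw [← (Equiv.funUnique (TV k 0) Bool).symm.sum_comp, Fintype.sum_bool]
  simp

lemma blockedProb_zero (k m : ℕ) (p : ℝ) : blockedProb k m 0 p = p :=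
  (mean_tree_zero p fun b => if b then 1 else 0).trans (by simp)

lemma blockedInd_succ (m : ℕ) (η : TV k (n + 1) → Bool) :
    blockedInd k m (n + 1) η = if η (rootT k (n + 1)) then
      (if m ≤ (Finset.univ.filter fun a => blocked k m n (fun y => η (subT a y)) = true).card
        then 1 else 0) else 0 := by
  unfold blockedInd
  rw [blocked]
  cases η (rootT k (n + 1)) <;> simp

lemma blockedProb_eq_sum (m : ℕ) (p : ℝ) :
    ∑ ω : TV k n → Bool, wt p ω * (if blocked k m n ω then 1 else 0) = blockedProb k m n p := rfl

lemma sum_wt (p : ℝ) : ∑ ω : TV k n → Bool, wt p ω = 1 := by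
  simpa [mean] using mean_const_one (V := TV k n) p

lemma blockedProb_succ (k m n : ℕ) (p : ℝ) :
    blockedProb k m (n + 1) p = p * binomTail k m (blockedProb k m n p) := by
  have h := mean_tree_succ (k := k) (n := n) p fun b ξ => if b then
    (if m ≤ (Finset.univ.filter fun a => blocked k m n (ξ a) = true).card then 1 else 0) else 0
  have h' := sum_prod_mul_card (ι := Fin k) (wt p) (sum_wt p) (blocked k m n)
    (fun i => if m ≤ i then 1 else 0)
  rw [blockedProb_eq_sum, Fintype.card_fin] at h'
  rw [blockedProb, funext (blockedInd_succ m), h]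
  simp only [if_true, Bool.false_eq_true, if_false, mul_zero, add_zero, mul_left_comm _ p]
  rw [← Finset.mul_sum, h', binomTail]
  simp only [mul_ite, mul_one, mul_zero]
  rw [← Finset.sum_filter]
  congr 1
  exact Finset.sum_congr (by ext; simp; omega) fun _ _ => rfl

lemma cbar_mul_cvar_rootT {j : ℕ} (hjk : j ≤ k) (p : ℝ) (η : TV k (n + 1) → Bool) :
    cbar j (rootT k (n + 1)) η *
      cvar p {rootT k (n + 1)} (blockedInd k (k - j + 1) (n + 1)) η = 0 := by
  rw [cbar_rootT]
  split_ifs with h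
  swap
  · exact zero_mul _
  have hlt : (Finset.univ.filter fun a =>
      blocked k (k - j + 1) n (fun y => η (subT a y)) = true).card < k - j + 1 := by
    have hsub : (Finset.univ.filter fun a =>
        blocked k (k - j + 1) n (fun y => η (subT a y)) = true).card ≤
        (Finset.univ.filter fun a => ¬ η (subT a (rootT k n)) = false).card :=
      Finset.card_le_card fun a ha => by
        have := rootT_of_blocked (Finset.mem_filter.mp ha).2
        simp [this]
    have hadd := Finset.card_filter_add_card_filter_not (s := (Finset.univ : Finset (Fin k)))
      (fun a => η (subT a (rootT k n)) = false)
    rw [Finset.card_univ, Fintype.card_fin] at hadd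
    omega
  have hzero (c : Bool) : blockedInd k (k - j + 1) (n + 1)
      (Function.update η (rootT k (n + 1)) c) = 0 := by
    rw [blockedInd_succ]
    simp only [Function.update_of_ne (subT_ne_rootT _ _), not_le.mpr hlt, if_false, ite_self]
  rw [cvar_singleton, hzero, hzero]
  simp

/-- Whether the blocking of the root depends on the blocking of its child `a`. -/
def pivotal (k m n : ℕ) (a : Fin k) (ξ : Fin k → TV k n → Bool) : ℝ :=
  if (Finset.univ.filter fun c => c ≠ a ∧ blocked k m n (ξ c) = true).card + 1 = m then 1 else 0

lemma card_blocked_eq (m : ℕ) (a : Fin k) (ξ : Fin k → TV k n → Bool) :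
    (Finset.univ.filter fun c => blocked k m n (ξ c) = true).card =
      (Finset.univ.filter fun c => c ≠ a ∧ blocked k m n (ξ c) = true).card +
        if blocked k m n (ξ a) then 1 else 0 := by
  rw [Finset.card_filter, Finset.card_filter, ← Finset.add_sum_erase _ _ (Finset.mem_univ a),
    ← Finset.add_sum_erase _ (fun c => if c ≠ a ∧ blocked k m n (ξ c) = true then 1 else 0)
      (Finset.mem_univ a), add_comm]
  simp only [ne_eq, not_true_eq_false, false_and, if_false, zero_add]
  congr 1
  exact Finset.sum_congr rfl fun c hc => by simp [Finset.ne_of_mem_erase hc]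

lemma card_filter_ne_update (m : ℕ) (a : Fin k) (ξ : Fin k → TV k n → Bool) (ω : TV k n → Bool) :
    (Finset.univ.filter fun c => c ≠ a ∧ blocked k m n (Function.update ξ a ω c) = true).card =
      (Finset.univ.filter fun c => c ≠ a ∧ blocked k m n (ξ c) = true).card := by
  congr 1
  refine Finset.filter_congr fun c _ => and_congr_right fun hc => ?_
  rw [Function.update_of_ne hc]

lemma cvar_subT (m : ℕ) (p : ℝ) (a : Fin k) (y : TV k n) (η : TV k (n + 1) → Bool) :
    cvar p {subT a y} (blockedInd k m (n + 1)) η =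
      if η (rootT k (n + 1)) then
        pivotal k m n a (fun a y => η (subT a y)) *
          cvar p {y} (blockedInd k m n) (fun y => η (subT a y))
      else 0 := by
  set ξ : Fin k → TV k n → Bool := fun a y => η (subT a y) with hξ
  have hroot (c : Bool) : Function.update η (subT a y) c (rootT k (n + 1)) =
      η (rootT k (n + 1)) := Function.update_of_ne (subT_ne_rootT a y).symm _ _
  have hsub (c : Bool) : (fun a' y' => Function.update η (subT a y) c (subT a' y')) =
      Function.update ξ a (Function.update (ξ a) y c) := by
    funext a' y'
    by_cases ha : a' = a
    · subst ha
      by_cases hy : y' = y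
      · subst hy
        simp
      · have : subT a' y' ≠ subT a' y := fun h => hy (subT_inj h).2
        simp [this, hy, hξ]
    · have : subT a' y' ≠ subT a y := fun h => ha (subT_inj h).1
      simp [this, ha, hξ]
  have hcard (c : Bool) : (Finset.univ.filter fun a' =>
      blocked k m n (fun y' => Function.update η (subT a y) c (subT a' y')) = true).card =
      (Finset.univ.filter fun c => c ≠ a ∧ blocked k m n (ξ c) = true).card +
        if blocked k m n (Function.update (ξ a) y c) then 1 else 0 := by
    have h := card_blocked_eq m a (Function.update ξ a (Function.update (ξ a) y c))
    rw [card_filter_ne_update, Function.update_self, ← hsub c] at h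
    exact h
  rw [cvar_singleton, cvar_singleton, blockedInd_succ, blockedInd_succ, hroot, hroot,
    hcard, hcard, pivotal, blockedInd, blockedInd]
  set r := (Finset.univ.filter fun c => c ≠ a ∧ blocked k m n (ξ c) = true).card
  cases η (rootT k (n + 1))
  · simp
  cases blocked k m n (Function.update (ξ a) y true) <;>
    cases blocked k m n (Function.update (ξ a) y false)
  · simp
  · rcases lt_trichotomy (r + 1) m with h | h | h
    · simp [show ¬ m ≤ r by omega, show ¬ m ≤ r + 1 by omega, h.ne]
    · simp [show ¬ m ≤ r by omega, h]
    · simp [show m ≤ r by omega, show m ≤ r + 1 by omega, h.ne']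
  · rcases lt_trichotomy (r + 1) m with h | h | h
    · simp [show ¬ m ≤ r by omega, show ¬ m ≤ r + 1 by omega, h.ne]
    · simp [show ¬ m ≤ r by omega, h]
    · simp [show m ≤ r by omega, show m ≤ r + 1 by omega, h.ne']
  · simp

lemma sum_blockedInd_mul_pivotal (m : ℕ) (ξ : Fin k → TV k n → Bool) :
    ∑ a, blockedInd k m n (ξ a) * pivotal k m n a ξ =
      if (Finset.univ.filter fun c => blocked k m n (ξ c) = true).card = m then (m : ℝ) else 0 := by
  set s := (Finset.univ.filter fun c => blocked k m n (ξ c) = true).card with hs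
  have hterm (a : Fin k) : blockedInd k m n (ξ a) * pivotal k m n a ξ =
      (if s = m then 1 else 0) * (if blocked k m n (ξ a) then 1 else 0) := by
    have h := card_blocked_eq m a ξ
    rw [← hs] at h
    unfold blockedInd pivotal
    by_cases hb : blocked k m n (ξ a) = true
    · rw [if_pos hb] at h
      rw [← h]
      simp [hb]
    · simp [hb]
  simp only [hterm]
  rw [← Finset.mul_sum, Finset.sum_boole, ← hs]
  split_ifs with h <;> simp [h]

lemma blockedProb_mul_dirO_succ {j : ℕ} (hj : 1 ≤ j) (hjk : j ≤ k) (n : ℕ) (p : ℝ) :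
    blockedProb k (k - j + 1) n p * dirO k j (n + 1) p (blockedInd k (k - j + 1) (n + 1)) =
      p * dirO k j n p (blockedInd k (k - j + 1) n) *
        binomPivot k (k - j + 1) (blockedProb k (k - j + 1) n p) := by
  set m := k - j + 1 with hm
  let S : (TV k n → Bool) → ℝ := fun ω => ∑ y, cbar j y ω * cvar p {y} (blockedInd k m n) ω
  have hS : ∑ ω, wt p ω * S ω = dirO k j n p (blockedInd k m n) := by
    simp only [S, dirO, mean, Finset.mul_sum]
    exact Finset.sum_comm
  have hterm (a : Fin k) (y : TV k n) : mean p (fun η => cbar j (subT a y) η *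
      cvar p {subT a y} (blockedInd k m (n + 1)) η) = p * ∑ ξ : Fin k → TV k n → Bool,
        (∏ c, wt p (ξ c)) * ((cbar j y (ξ a) * cvar p {y} (blockedInd k m n) (ξ a)) *
          pivotal k m n a ξ) := by
    have h := mean_tree_succ (k := k) (n := n) p fun b ξ => cbar j y (ξ a) *
      if b then pivotal k m n a ξ * cvar p {y} (blockedInd k m n) (ξ a) else 0
    simp only [cbar_subT, cvar_subT]
    refine h.trans ?_
    rw [Finset.mul_sum]
    refine Finset.sum_congr rfl fun ξ _ => ?_
    simp only [if_true, Bool.false_eq_true, if_false]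
    ring
  have hdir : dirO k j (n + 1) p (blockedInd k m (n + 1)) =
      p * ∑ a, ∑ ξ : Fin k → TV k n → Bool,
        (∏ c, wt p (ξ c)) * (S (ξ a) * pivotal k m n a ξ) := by
    have hroot : mean p (fun η => cbar j (rootT k (n + 1)) η *
        cvar p {rootT k (n + 1)} (blockedInd k m (n + 1)) η) = 0 := by
      simp only [mean, hm, cbar_mul_cvar_rootT hjk, mul_zero, Finset.sum_const_zero]
    rw [dirO, sum_tree_succ, hroot, zero_add]
    simp only [hterm]
    simp only [← Finset.mul_sum]
    congr 1
    refine Finset.sum_congr rfl fun a _ => ?_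
    rw [Finset.sum_comm]
    refine Finset.sum_congr rfl fun ξ _ => ?_
    rw [← Finset.mul_sum, ← Finset.sum_mul]
  have hex (a : Fin k) : blockedProb k m n p * ∑ ξ : Fin k → TV k n → Bool,
        (∏ c, wt p (ξ c)) * (S (ξ a) * pivotal k m n a ξ) =
      dirO k j n p (blockedInd k m n) * ∑ ξ : Fin k → TV k n → Bool,
        (∏ c, wt p (ξ c)) * (blockedInd k m n (ξ a) * pivotal k m n a ξ) := by
    rw [← hS]
    exact sum_prod_mul_exchange (wt p) a S (blockedInd k m n) (pivotal k m n a)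
      fun ξ ω => by simp only [pivotal, card_filter_ne_update]
  have hcard := sum_prod_mul_card (ι := Fin k) (wt p) (sum_wt p) (blocked k m n)
    (fun i => if i = m then (m : ℝ) else 0)
  rw [blockedProb_eq_sum, Fintype.card_fin] at hcard
  rw [hdir, mul_left_comm, Finset.mul_sum, Finset.sum_congr rfl fun a _ => hex a,
    ← Finset.mul_sum, Finset.sum_comm, mul_assoc]
  simp only [← Finset.mul_sum, sum_blockedInd_mul_pivotal]
  rw [hcard, Finset.sum_eq_single_of_mem m (by simp; omega)
    (fun i _ hi => by simp [hi]), binomPivot, if_pos rfl, mul_comm (m : ℝ)]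

lemma dirO_zero (j m : ℕ) (p : ℝ) : dirO k j 0 p (blockedInd k m 0) = p * (1 - p) := by
  let : Unique (TV k 0) := ⟨⟨rootT k 0⟩, eq_rootT_of_depth_zero⟩
  have hterm (η : TV k 0 → Bool) :
      cbar j (rootT k 0) η * cvar p {rootT k 0} (blockedInd k m 0) η = p * (1 - p) * 1 := by
    rw [cvar_singleton, cbar, if_pos (show (rootT k 0).1.val = 0 from rfl)]
    simp [blockedInd, blocked]
  rw [dirO, Fintype.sum_unique]
  change mean p (fun η => cbar j (rootT k 0) η * cvar p {rootT k 0} (blockedInd k m 0) η) = _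
  simp only [hterm, mean]
  simp only [mul_one, ← Finset.sum_mul, sum_wt, one_mul]

end Blocked

theorem gap_upper_bound_above_ptilde (k j : ℕ) (p : ℝ) (hk : 2 ≤ k) (hj : 2 ≤ j) (hjk : j ≤ k)
    (hp1 : ptilde k j < p) (hp2 : p < 1) :
    ∃ c > (0 : ℝ), ∀ L : ℕ, 1 ≤ L → gapO k j L p ≤ Real.exp (-(L / c)) := by
  obtain ⟨w, hw0, hw1, hfix, hlt⟩ := exists_fixedPoint_binomPivot_lt hj hjk hp1 hp2
  set m := k - j + 1 with hmdef
  have hm : 1 ≤ m := by omega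
  have hmk : m ≤ k := by omega
  have hBw : 0 < binomPivot k m w := binomPivot_pos hm hmk hw0 hw1
  have hTw : 0 < binomTail k m w := hBw.trans hlt
  have hp0 : 0 < p := pos_of_mul_pos_left (hfix.symm ▸ hw0) hTw.le
  have hmono := monotoneOn_binomTail hm hmk
  have hTle {x : ℝ} (hx : x ∈ Set.Icc (0 : ℝ) 1) : binomTail k m x ≤ 1 :=
    binomTail_one hmk ▸ hmono hx (Set.right_mem_Icc.mpr zero_le_one) hx.2
  have hwp : w ≤ p := by
    have := hTle ⟨hw0.le, hw1.le⟩
    nlinarith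
  have hbound (n : ℕ) : w ≤ blockedProb k m n p ∧ blockedProb k m n p ≤ p := by
    induction n with
    | zero => rw [blockedProb_zero]; exact ⟨hwp, le_rfl⟩
    | succ n ih =>
      have hmem : blockedProb k m n p ∈ Set.Icc (0 : ℝ) 1 :=
        ⟨hw0.le.trans ih.1, ih.2.trans hp2.le⟩
      rw [blockedProb_succ]
      refine ⟨?_, mul_le_of_le_one_right hp0.le (hTle hmem)⟩
      calc w = p * binomTail k m w := hfix.symm
        _ ≤ _ := mul_le_mul_of_nonneg_left (hmono ⟨hw0.le, hw1.le⟩ hmem ih.1) hp0.le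
  obtain ⟨ρ, hρ⟩ : ∃ ρ, ρ = binomPivot k m w / binomTail k m w := ⟨_, rfl⟩
  have hρ0 : 0 < ρ := hρ ▸ div_pos hBw hTw
  have hρ1 : ρ < 1 := hρ ▸ (div_lt_one hTw).mpr hlt
  have hpivot {x : ℝ} (hx : w ≤ x) (hx1 : x ≤ 1) : binomPivot k m x ≤ ρ * binomTail k m x := by
    rw [hρ, div_mul_eq_mul_div, le_div_iff₀ hTw]
    exact binomPivot_mul_le k m hw0.le hx hx1
  have hdir (n : ℕ) :
      dirO k j n p (blockedInd k m n) ≤ (1 - p) * ρ ^ n * blockedProb k m n p := by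
    induction n with
    | zero => rw [dirO_zero, blockedProb_zero]; linarith
    | succ n ih =>
      obtain ⟨hwx, hxp⟩ := hbound n
      have hx0 : 0 < blockedProb k m n p := hw0.trans_le hwx
      have hx1 := hxp.trans hp2.le
      have hB := binomPivot_pos hm hmk hx0 (hxp.trans_lt hp2)
      refine le_of_mul_le_mul_left ?_ hx0
      rw [blockedProb_mul_dirO_succ (by omega) hjk, ← hmdef, blockedProb_succ]
      calc _ ≤ p * ((1 - p) * ρ ^ n * blockedProb k m n p) *
              binomPivot k m (blockedProb k m n p) := by gcongr
        _ ≤ p * ((1 - p) * ρ ^ n * blockedProb k m n p) *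
              (ρ * binomTail k m (blockedProb k m n p)) := by
          have : 0 ≤ 1 - p := by linarith
          exact mul_le_mul_of_nonneg_left (hpivot hwx hx1) (by positivity)
        _ = _ := by ring
  have hlog : 0 < -Real.log ρ := neg_pos.mpr (Real.log_neg hρ0 hρ1)
  refine ⟨(-Real.log ρ)⁻¹, inv_pos.mpr hlog, fun L _ => ?_⟩
  have hexp : Real.exp (-((L : ℝ) / (-Real.log ρ)⁻¹)) = ρ ^ L := by
    rw [div_inv_eq_mul, mul_neg, neg_neg, Real.exp_nat_mul, Real.exp_log hρ0]
  rw [hexp]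
  obtain ⟨hwx, hxp⟩ := hbound L
  have hx0 : 0 < blockedProb k m L p := hw0.trans_le hwx
  have hvar : 0 < varTot p (blockedInd k m L) := by
    rw [varTot_blockedInd]
    exact mul_pos hx0 (by linarith)
  have hratio : dirO k j L p (blockedInd k m L) / varTot p (blockedInd k m L) ≤ ρ ^ L := by
    rw [div_le_iff₀ hvar, varTot_blockedInd]
    refine (hdir L).trans ?_
    calc (1 - p) * ρ ^ L * blockedProb k m L p
        = ρ ^ L * (blockedProb k m L p * (1 - p)) := by ring
      _ ≤ _ := by gcongr
  unfold gapO
  by_cases hbdd : BddBelow {r : ℝ | ∃ f : (TV k L → Bool) → ℝ,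
      varTot p f ≠ 0 ∧ r = dirO k j L p f / varTot p f}
  · exact (csInf_le hbdd ⟨blockedInd k m L, hvar.ne', rfl⟩).trans hratio
  · rw [Real.sInf_of_not_bddBelow hbdd]
    positivity
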